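/- Let q be meromorphic near z₀ with Laurent expansion q(z) = Σ_{j≥0} q_j (z-z₀)^{j-2} where q_0 = -s(s+1) and Re(2s+1) ≥ 0. Define f_0(σ) = (s+σ)(s+1-σ), and recursively c_0(σ) as given (c_0 = 1 if 2s+1 ∉ ℕ, else Π_{j=1}^{2s+1} f_0(σ+j)), c_j(σ) = (Σ_{m=0}^{j-1} q_{j-m} c_m(σ))/f_0(σ+j). Then the equation y'' + q y = 0 has a fundamental system of solutions meromorphic near z₀ if and only if s ∈ ℕ₀ and c_{2s+1}(-s) = 0. -/

import Mathlib

open Metric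
open Filter Topology Finset

/-- `a` is the sequence of Taylor coefficients of `g` at `z₀`. -/
def HasTaylorAt (a : ℕ → ℂ) (g : ℂ → ℂ) (z₀ : ℂ) : Prop :=
  ∀ᶠ z in 𝓝 z₀, HasSum (fun j => a j * (z - z₀) ^ j) (g z)

theorem hasTaylorAt_iff {a : ℕ → ℂ} {g : ℂ → ℂ} {z₀ : ℂ} :
    HasTaylorAt a g z₀ ↔
      HasFPowerSeriesAt g (FormalMultilinearSeries.ofScalars ℂ a) z₀ := by
  rw [hasFPowerSeriesAt_iff']
  simp [HasTaylorAt, FormalMultilinearSeries.coeff_ofScalars, mul_comm]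

theorem HasTaylorAt.analyticAt {a : ℕ → ℂ} {g : ℂ → ℂ} {z₀ : ℂ} (h : HasTaylorAt a g z₀) :
    AnalyticAt ℂ g z₀ :=
  (hasTaylorAt_iff.1 h).analyticAt

theorem AnalyticAt.hasTaylorAt {g : ℂ → ℂ} {z₀ : ℂ} (h : AnalyticAt ℂ g z₀) :
    HasTaylorAt (fun n => iteratedDeriv n g z₀ / n.factorial) g z₀ :=
  hasTaylorAt_iff.2 h.hasFPowerSeriesAt

theorem HasTaylorAt.unique {a b : ℕ → ℂ} {g : ℂ → ℂ} {z₀ : ℂ} (ha : HasTaylorAt a g z₀)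
    (hb : HasTaylorAt b g z₀) : a = b := by
  have h := (hasTaylorAt_iff.1 ha).eq_formalMultilinearSeries (hasTaylorAt_iff.1 hb)
  funext n
  simpa using congrArg (fun p => p.coeff n) h

theorem HasTaylorAt.congr {a : ℕ → ℂ} {g h : ℂ → ℂ} {z₀ : ℂ} (ha : HasTaylorAt a g z₀)
    (hgh : g =ᶠ[𝓝 z₀] h) : HasTaylorAt a h z₀ := by
  filter_upwards [ha, hgh] with z hz he using he ▸ hz

theorem HasTaylorAt.eval {a : ℕ → ℂ} {g : ℂ → ℂ} {z₀ : ℂ} (ha : HasTaylorAt a g z₀) :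
    g z₀ = a 0 := by
  refine ha.self_of_nhds.unique ?_
  simpa using hasSum_single (f := fun j => a j * (z₀ - z₀) ^ j) 0 (by simp +contextual)

theorem HasTaylorAt.deriv {a : ℕ → ℂ} {g : ℂ → ℂ} {z₀ : ℂ} (ha : HasTaylorAt a g z₀) :
    HasTaylorAt (fun j => (j + 1) * a (j + 1)) (deriv g) z₀ := by
  have h := ha.analyticAt.deriv.hasTaylorAt
  rw [ha.unique ha.analyticAt.hasTaylorAt]
  convert h using 2 with n
  simp only [iteratedDeriv_succ', Nat.factorial_succ]
  have := Nat.factorial_ne_zero n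
  push_cast
  field_simp

theorem HasTaylorAt.add {a b : ℕ → ℂ} {g h : ℂ → ℂ} {z₀ : ℂ} (ha : HasTaylorAt a g z₀)
    (hb : HasTaylorAt b h z₀) : HasTaylorAt (fun j => a j + b j) (fun z => g z + h z) z₀ := by
  filter_upwards [ha, hb] with z hz hz'
  simpa [add_mul] using hz.add hz'

theorem HasTaylorAt.const_mul {a : ℕ → ℂ} {g : ℂ → ℂ} {z₀ : ℂ} (ha : HasTaylorAt a g z₀)
    (t : ℂ) : HasTaylorAt (fun j => t * a j) (fun z => t * g z) z₀ := by
  filter_upwards [ha] with z hz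
  simpa [mul_assoc] using hz.mul_left t

theorem HasTaylorAt.mul {a b : ℕ → ℂ} {g h : ℂ → ℂ} {z₀ : ℂ} (ha : HasTaylorAt a g z₀)
    (hb : HasTaylorAt b h z₀) :
    HasTaylorAt (fun j => ∑ p ∈ antidiagonal j, a p.1 * b p.2) (fun z => g z * h z) z₀ := by
  filter_upwards [ha, hb] with z hz hz'
  have h1 := hz.summable.norm
  have h2 := hz'.summable.norm
  have key : ∀ n, ∑ p ∈ antidiagonal n, (a p.1 * (z - z₀) ^ p.1) * (b p.2 * (z - z₀) ^ p.2)
      = (∑ p ∈ antidiagonal n, a p.1 * b p.2) * (z - z₀) ^ n := by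
    intro n
    rw [sum_mul]
    refine sum_congr rfl fun p hp => ?_
    rw [← mem_antidiagonal.1 hp]
    ring
  have h3 := (summable_norm_sum_mul_antidiagonal_of_summable_norm h1 h2).of_norm
  have h4 := tsum_mul_tsum_eq_tsum_sum_antidiagonal_of_summable_norm h1 h2
  simp only [key] at h3 h4
  rw [hz.tsum_eq, hz'.tsum_eq] at h4
  rw [h4]
  exact h3.hasSum

theorem HasTaylorAt.sub_mul {a : ℕ → ℂ} {g : ℂ → ℂ} {z₀ : ℂ}
    (ha : HasTaylorAt (fun j => a (j + 1)) g z₀) (h0 : a 0 = 0) :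
    HasTaylorAt a (fun z => (z - z₀) * g z) z₀ := by
  filter_upwards [ha] with z hz
  have h := (hz.mul_left (z - z₀)).congr_fun (g := fun j => a (j + 1) * (z - z₀) ^ (j + 1))
    fun n => by ring
  have h' := (hasSum_nat_add_iff (f := fun j => a j * (z - z₀) ^ j) 1).1 h
  simpa [h0] using h'

/-- The left-hand side of `y'' + q y = 0` for `y = (z - z₀) ^ e * g`, divided by
`(z - z₀) ^ (e - 2)`, where `Q = (z - z₀) ^ 2 * q`. -/
noncomputable def frobeniusOperator (e : ℤ) (z₀ : ℂ) (Q g : ℂ → ℂ) (z : ℂ) : ℂ :=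
  e * (e - 1) * g z + 2 * e * ((z - z₀) * deriv g z)
    + (z - z₀) * ((z - z₀) * deriv (deriv g) z) + Q z * g z

theorem HasTaylorAt.frobeniusOperator {b a : ℕ → ℂ} {Q g : ℂ → ℂ} {z₀ : ℂ} (e : ℤ)
    (hb : HasTaylorAt b Q z₀) (ha : HasTaylorAt a g z₀) :
    HasTaylorAt (fun j => ((e : ℂ) + j) * (e + j - 1) * a j
      + ∑ p ∈ antidiagonal j, b p.1 * a p.2) (frobeniusOperator e z₀ Q g) z₀ := by
  have h1 : HasTaylorAt (fun j => (j : ℂ) * a j) (fun z => (z - z₀) * _root_.deriv g z) z₀ :=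
    HasTaylorAt.sub_mul (by simpa using ha.deriv) (by simp)
  have h2 : HasTaylorAt (fun j => (j : ℂ) * ((j + 1) * a (j + 1)))
      (fun z => (z - z₀) * _root_.deriv (_root_.deriv g) z) z₀ :=
    HasTaylorAt.sub_mul (by simpa using ha.deriv.deriv) (by simp)
  have h3 : HasTaylorAt (fun j => (j : ℂ) * ((j - 1) * a j))
      (fun z => (z - z₀) * ((z - z₀) * _root_.deriv (_root_.deriv g) z)) z₀ := by
    refine HasTaylorAt.sub_mul ?_ (by simp)
    convert h2 using 2 with j
    push_cast
    ring
  convert (((ha.const_mul (e * (e - 1))).add (h1.const_mul (2 * e))).add h3).add (hb.mul ha)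
    using 2 with j z
  · ring
  · rfl

theorem deriv_zpow_mul {g : ℂ → ℂ} {z₀ z : ℂ} (e : ℤ) (hz : z ≠ z₀)
    (hg : DifferentiableAt ℂ g z) :
    deriv (fun w => (w - z₀) ^ e * g w) z
      = e * (z - z₀) ^ (e - 1) * g z + (z - z₀) ^ e * deriv g z := by
  have h0 : z - z₀ ≠ 0 := sub_ne_zero.2 hz
  have h1 : HasDerivAt (fun w => (w - z₀) ^ e) (e * (z - z₀) ^ (e - 1)) z :=
    (hasDerivAt_zpow e (z - z₀) (Or.inl h0)).comp_sub_const z z₀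
  exact (h1.mul hg.hasDerivAt).deriv

theorem eventually_nhdsNE_analyticAt {g : ℂ → ℂ} {z₀ : ℂ} (hg : AnalyticAt ℂ g z₀) :
    ∀ᶠ z in 𝓝[≠] z₀, AnalyticAt ℂ g z ∧ z ≠ z₀ :=
  (hg.eventually_analyticAt.filter_mono nhdsWithin_le_nhds).and eventually_mem_nhdsWithin

theorem eventually_deriv_zpow_mul {g : ℂ → ℂ} {z₀ : ℂ} (e : ℤ) (hg : AnalyticAt ℂ g z₀) :
    deriv (fun w => (w - z₀) ^ e * g w) =ᶠ[𝓝[≠] z₀]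
      fun z => (z - z₀) ^ (e - 1) * (e * g z + (z - z₀) * deriv g z) := by
  filter_upwards [eventually_nhdsNE_analyticAt hg] with z ⟨hz, hne⟩
  have h0 : z - z₀ ≠ 0 := sub_ne_zero.2 hne
  rw [deriv_zpow_mul e hne hz.differentiableAt, zpow_sub_one₀ h0]
  field_simp

theorem eventually_ode_zpow_mul {Q q g : ℂ → ℂ} {z₀ : ℂ} (e : ℤ) (hg : AnalyticAt ℂ g z₀)
    (hQ : ∀ᶠ z in 𝓝[≠] z₀, Q z = (z - z₀) ^ 2 * q z) :
    ∀ᶠ z in 𝓝[≠] z₀, deriv (deriv fun w => (w - z₀) ^ e * g w) z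
      + q z * ((z - z₀) ^ e * g z) = (z - z₀) ^ (e - 2) * frobeniusOperator e z₀ Q g z := by
  have hg' : AnalyticAt ℂ (fun z => e * g z + (z - z₀) * deriv g z) z₀ := by
    have := hg.deriv
    fun_prop
  have h1 := (eventually_deriv_zpow_mul e hg).nhdsNE_deriv.trans
    (eventually_deriv_zpow_mul (e - 1) hg')
  filter_upwards [h1, hQ, eventually_nhdsNE_analyticAt hg] with z hz hQz ⟨hgz, hne⟩
  have h0 : z - z₀ ≠ 0 := sub_ne_zero.2 hne
  have hd : deriv (fun z => e * g z + (z - z₀) * deriv g z) z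
      = e * deriv g z + (deriv g z + (z - z₀) * deriv (deriv g) z) := by
    have h2 := hgz.differentiableAt.hasDerivAt
    have h3 := hgz.deriv.differentiableAt.hasDerivAt
    have h4 := ((h2.const_mul (e : ℂ)).fun_add (((hasDerivAt_id' z).sub_const z₀).fun_mul h3)).deriv
    rwa [one_mul] at h4
  rw [hz, hd, frobeniusOperator, hQz]
  have e1 : (z - z₀) ^ e = (z - z₀) ^ (e - 2) * (z - z₀) ^ 2 := by
    rw [← zpow_natCast, ← zpow_add₀ h0]
    simp
  rw [e1, show e - 1 - 1 = e - 2 by ring]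
  push_cast
  ring

theorem exists_coeff_of_meromorphicOrderAt_eq {b : ℕ → ℂ} {Q q y : ℂ → ℂ} {z₀ : ℂ} {e : ℤ}
    (hb : HasTaylorAt b Q z₀) (hQ : ∀ᶠ z in 𝓝[≠] z₀, Q z = (z - z₀) ^ 2 * q z)
    (hy : MeromorphicAt y z₀)
    (hode : ∀ᶠ z in 𝓝[≠] z₀, deriv (deriv y) z + q z * y z = 0)
    (he : meromorphicOrderAt y z₀ = e) :
    ∃ a : ℕ → ℂ, a 0 ≠ 0 ∧ ∀ j : ℕ, ((e : ℂ) + j) * (e + j - 1) * a j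
      + ∑ p ∈ antidiagonal j, b p.1 * a p.2 = 0 := by
  obtain ⟨g, hg, hg0, hyg⟩ := (meromorphicOrderAt_eq_int_iff hy).1 he
  obtain ⟨a, ha⟩ : ∃ a, HasTaylorAt a g z₀ := ⟨_, hg.hasTaylorAt⟩
  refine ⟨a, ha.eval ▸ hg0, fun j => ?_⟩
  have hH := HasTaylorAt.frobeniusOperator e hb ha
  have hyg' : y =ᶠ[𝓝[≠] z₀] fun w => (w - z₀) ^ e * g w := hyg
  have hzero : ∀ᶠ z in 𝓝[≠] z₀, frobeniusOperator e z₀ Q g z = 0 := by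
    filter_upwards [hode, hyg', hyg'.nhdsNE_deriv.nhdsNE_deriv, eventually_ode_zpow_mul e hg hQ,
      eventually_mem_nhdsWithin] with z h1 h2 h3 h4 hne
    rw [← h3, ← h2, h1] at h4
    exact (mul_eq_zero.1 h4.symm).resolve_left (zpow_ne_zero _ (sub_ne_zero.2 hne))
  have hzero' : frobeniusOperator e z₀ Q g =ᶠ[𝓝 z₀] fun _ => 0 :=
    (hH.analyticAt.frequently_eq_iff_eventually_eq analyticAt_const).1 hzero.frequently
  have h0 : HasTaylorAt (fun _ => 0) (fun _ => 0) z₀ :=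
    Eventually.of_forall fun z => by simp
  exact congrFun ((hH.congr hzero').unique h0) j

/-- The Wronskian of two functions. -/
noncomputable def wronskian (y₁ y₂ : ℂ → ℂ) (z : ℂ) : ℂ :=
  y₁ z * deriv y₂ z - y₂ z * deriv y₁ z

theorem wronskian_swap (y₁ y₂ : ℂ → ℂ) (z : ℂ) : wronskian y₂ y₁ z = -wronskian y₁ y₂ z := by
  simp [wronskian]

theorem meromorphicOrderAt_ne_top_of_wronskian {y₁ y₂ : ℂ → ℂ} {z₀ : ℂ}
    (hW : ∀ᶠ z in 𝓝[≠] z₀, wronskian y₁ y₂ z ≠ 0) : meromorphicOrderAt y₁ z₀ ≠ ⊤ := by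
  intro h
  have h0 : y₁ =ᶠ[𝓝[≠] z₀] fun _ => 0 := meromorphicOrderAt_eq_top_iff.1 h
  obtain ⟨z, h1, h2, h3⟩ := (hW.and (h0.and h0.nhdsNE_deriv)).exists
  exact h1 (by simp [wronskian, h2, h3])

/-- A meromorphic fundamental system contains, up to linear combinations, solutions of two
different orders. -/
theorem exists_meromorphicOrderAt_ne {q y₁ y₂ : ℂ → ℂ} {z₀ : ℂ}
    (hy₁ : MeromorphicAt y₁ z₀) (hy₂ : MeromorphicAt y₂ z₀)
    (hode₁ : ∀ᶠ z in 𝓝[≠] z₀, deriv (deriv y₁) z + q z * y₁ z = 0)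
    (hode₂ : ∀ᶠ z in 𝓝[≠] z₀, deriv (deriv y₂) z + q z * y₂ z = 0)
    (hW : ∀ᶠ z in 𝓝[≠] z₀, wronskian y₁ y₂ z ≠ 0) :
    ∃ (u : ℂ → ℂ) (e₁ e₂ : ℤ), e₁ ≠ e₂ ∧ MeromorphicAt u z₀ ∧
      (∀ᶠ z in 𝓝[≠] z₀, deriv (deriv u) z + q z * u z = 0) ∧
      meromorphicOrderAt u z₀ = e₁ ∧ meromorphicOrderAt y₂ z₀ = e₂ := by
  have ht₁ := meromorphicOrderAt_ne_top_of_wronskian hW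
  have ht₂ : meromorphicOrderAt y₂ z₀ ≠ ⊤ := meromorphicOrderAt_ne_top_of_wronskian (y₂ := y₁) <|
    hW.mono fun z hz => by rwa [wronskian_swap, neg_ne_zero]
  obtain ⟨e₁, he₁⟩ := WithTop.ne_top_iff_exists.1 ht₁
  obtain ⟨e, he⟩ := WithTop.ne_top_iff_exists.1 ht₂
  by_cases hne : e₁ = e
  swap
  · exact ⟨y₁, e₁, e, hne, hy₁, hode₁, he₁.symm, he.symm⟩
  subst hne
  obtain ⟨g₁, hg₁, hg₁0, hyg₁⟩ := (meromorphicOrderAt_eq_int_iff hy₁).1 he₁.symm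
  obtain ⟨g₂, hg₂, hg₂0, hyg₂⟩ := (meromorphicOrderAt_eq_int_iff hy₂).1 he.symm
  set t := g₁ z₀ / g₂ z₀ with ht
  set u : ℂ → ℂ := fun z => y₁ z - t * y₂ z with hu_def
  have hu : MeromorphicAt u z₀ := hy₁.sub ((MeromorphicAt.const t z₀).mul hy₂)
  have hd : deriv u =ᶠ[𝓝[≠] z₀] fun z => deriv y₁ z - t * deriv y₂ z := by
    filter_upwards [hy₁.eventually_analyticAt, hy₂.eventually_analyticAt] with z h1 h2
    exact (h1.differentiableAt.hasDerivAt.fun_sub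
      (h2.differentiableAt.hasDerivAt.const_mul t)).deriv
  have hdd : deriv (deriv u) =ᶠ[𝓝[≠] z₀]
      fun z => deriv (deriv y₁) z - t * deriv (deriv y₂) z := by
    refine hd.nhdsNE_deriv.trans ?_
    filter_upwards [hy₁.eventually_analyticAt, hy₂.eventually_analyticAt] with z h1 h2
    exact (h1.deriv.differentiableAt.hasDerivAt.fun_sub
      (h2.deriv.differentiableAt.hasDerivAt.const_mul t)).deriv
  have hode : ∀ᶠ z in 𝓝[≠] z₀, deriv (deriv u) z + q z * u z = 0 := by
    filter_upwards [hdd, hode₁, hode₂] with z h1 h2 h3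
    rw [h1]
    linear_combination h2 - t * h3
  have htu : meromorphicOrderAt u z₀ ≠ ⊤ := by
    refine meromorphicOrderAt_ne_top_of_wronskian (y₂ := y₂) ?_
    filter_upwards [hW, hd] with z h1 h2
    convert h1 using 1
    simp only [wronskian, h2]
    ring
  obtain ⟨e', he'⟩ := WithTop.ne_top_iff_exists.1 htu
  refine ⟨u, e', e₁, ?_, hu, hode, he'.symm, he.symm⟩
  rintro rfl
  obtain ⟨g, hg, hg0, hug⟩ := (meromorphicOrderAt_eq_int_iff hu).1 he'.symm
  have hgeq : ∀ᶠ z in 𝓝[≠] z₀, g z = g₁ z - t * g₂ z := by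
    filter_upwards [hug, hyg₁, hyg₂, eventually_mem_nhdsWithin] with z h h1 h2 hne
    have h0 : (z - z₀) ^ e' ≠ 0 := zpow_ne_zero _ (sub_ne_zero.2 hne)
    simp only [hu_def, smul_eq_mul] at h h1 h2
    rw [h1, h2] at h
    apply mul_left_cancel₀ h0
    linear_combination -h
  have hg' : g z₀ = g₁ z₀ - t * g₂ z₀ := ((hg.frequently_eq_iff_eventually_eq
    (hg₁.fun_sub (analyticAt_const.fun_mul hg₂))).1 hgeq.frequently).self_of_nhds
  apply hg0
  rw [hg', ht]
  field_simp
  ring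

theorem indicial_add_antidiagonal {b : ℕ → ℂ} {s : ℂ} (hb0 : b 0 = -s * (s + 1)) (a : ℕ → ℂ)
    (σ : ℂ) (j : ℕ) :
    (σ + j) * (σ + j - 1) * a j + ∑ p ∈ antidiagonal j, b p.1 * a p.2
      = ∑ k ∈ range j, b (j - k) * a k - (s + (σ + j)) * (s + 1 - (σ + j)) * a j := by
  rw [← Nat.sum_antidiagonal_swap, Nat.sum_antidiagonal_eq_sum_range_succ_mk, sum_range_succ]
  simp only [Prod.swap, Nat.sub_self, hb0]
  ring

/-- The coefficients determined by `a 0 = 1` and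
`d (j + 1) * a (j + 1) = ∑ k ≤ j, b (j + 1 - k) * a k`, where `a (j + 1) = 0` if `d (j + 1) = 0`. -/
noncomputable def frobeniusCoeff (b d : ℕ → ℂ) : ℕ → ℂ
  | 0 => 1
  | j + 1 => (∑ k : Fin (j + 1), b (j + 1 - k) * frobeniusCoeff b d k) / d (j + 1)

theorem frobeniusCoeff_zero (b d : ℕ → ℂ) : frobeniusCoeff b d 0 = 1 := by
  rw [frobeniusCoeff]

theorem frobeniusCoeff_succ (b d : ℕ → ℂ) (j : ℕ) : frobeniusCoeff b d (j + 1)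
    = (∑ k ∈ range (j + 1), b (j + 1 - k) * frobeniusCoeff b d k) / d (j + 1) := by
  rw [frobeniusCoeff, ← Fin.sum_univ_eq_sum_range (fun k => b (j + 1 - k) * frobeniusCoeff b d k)]

theorem norm_frobeniusCoeff_le {b d : ℕ → ℂ} {K M : ℝ} (hK : 0 ≤ K) (hM : 0 ≤ M)
    (hb : ∀ j, ‖b j‖ ≤ M * K ^ j) (hd : ∀ j, d (j + 1) = 0 ∨ 1 ≤ ‖d (j + 1)‖) (j : ℕ) :
    ‖frobeniusCoeff b d j‖ ≤ (K * (M + 1)) ^ j := by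
  induction j using Nat.strong_induction_on with
  | _ j ih =>
    rcases j with _ | j
    · simp [frobeniusCoeff_zero]
    rw [frobeniusCoeff_succ]
    rcases hd j with h | h
    · simp only [h, div_zero, norm_zero]
      positivity
    have hsum : ‖∑ k ∈ range (j + 1), b (j + 1 - k) * frobeniusCoeff b d k‖
        ≤ (K * (M + 1)) ^ (j + 1) := by
      calc _ ≤ ∑ k ∈ range (j + 1), M * K ^ (j + 1) * (M + 1) ^ k := by
            refine norm_sum_le_of_le _ fun k hk => ?_
            have hk' := mem_range.1 hk
            rw [norm_mul]
            refine (mul_le_mul (hb _) (ih k hk') (norm_nonneg _) (by positivity)).trans_eq ?_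
            rw [mul_pow, ← Nat.sub_add_cancel hk'.le, pow_add]
            simp only [Nat.sub_add_cancel hk'.le]
            ring
        _ = K ^ (j + 1) * ((M + 1) ^ (j + 1) - 1) := by
            rw [← mul_sum, ← geom_sum_mul]
            ring
        _ ≤ _ := by
            rw [mul_pow]
            gcongr
            simp
    rw [norm_div]
    exact (div_le_self (norm_nonneg _) h).trans hsum

theorem HasTaylorAt.exists_norm_le {b : ℕ → ℂ} {Q : ℂ → ℂ} {z₀ : ℂ} (hb : HasTaylorAt b Q z₀) :
    ∃ K M : ℝ, 0 ≤ K ∧ 0 ≤ M ∧ ∀ j, ‖b j‖ ≤ M * K ^ j := by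
  obtain ⟨z, hz, hne⟩ :=
    ((hb.filter_mono nhdsWithin_le_nhds).and (eventually_mem_nhdsWithin (s := {z₀}ᶜ))).exists
  obtain ⟨M, hM⟩ := hz.summable.tendsto_atTop_zero.norm.bddAbove_range
  have h0 : 0 < ‖z - z₀‖ := norm_pos_iff.2 (sub_ne_zero.2 hne)
  have hM' : ∀ j, ‖b j‖ * ‖z - z₀‖ ^ j ≤ M := fun j => by
    simpa using hM (Set.mem_range_self j)
  refine ⟨‖z - z₀‖⁻¹, M, by positivity, (norm_nonneg (b 0)).trans (by simpa using hM' 0),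
    fun j => ?_⟩
  rw [inv_pow, ← div_eq_mul_inv, le_div_iff₀ (by positivity)]
  exact hM' j

theorem exists_hasTaylorAt_of_norm_le {a : ℕ → ℂ} {L : ℝ} (ha : ∀ j, ‖a j‖ ≤ L ^ j) (z₀ : ℂ) :
    ∃ g, HasTaylorAt a g z₀ := by
  have hL : 0 ≤ L := by simpa using (norm_nonneg _).trans (ha 1)
  refine ⟨fun z => ∑' j, a j * (z - z₀) ^ j, ?_⟩
  have hcont : Tendsto (fun z : ℂ => L * ‖z - z₀‖) (𝓝 z₀) (𝓝 0) := by
    have : Continuous fun z : ℂ => L * ‖z - z₀‖ := by fun_prop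
    simpa using this.tendsto z₀
  filter_upwards [hcont.eventually_lt_const one_pos] with z hz
  refine (Summable.of_norm_bounded (g := fun j => (L * ‖z - z₀‖) ^ j)
    (summable_geometric_of_lt_one (by positivity) hz) fun j => ?_).hasSum
  rw [norm_mul, norm_pow, mul_pow]
  gcongr
  exact ha j

theorem exists_frobenius_solution {b : ℕ → ℂ} {Q q : ℂ → ℂ} {z₀ s : ℂ} {e : ℤ}
    (hb : HasTaylorAt b Q z₀) (hQ : ∀ᶠ z in 𝓝[≠] z₀, Q z = (z - z₀) ^ 2 * q z)
    (hb0 : b 0 = -s * (s + 1)) {a : ℕ → ℂ} {L : ℝ} (ha : ∀ j, ‖a j‖ ≤ L ^ j)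
    (hrec : ∀ j : ℕ, (s + (e + j)) * (s + 1 - (e + j)) * a j
      = ∑ k ∈ range j, b (j - k) * a k) :
    ∃ g : ℂ → ℂ, AnalyticAt ℂ g z₀ ∧ g z₀ = a 0 ∧
      ∀ᶠ z in 𝓝[≠] z₀, deriv (deriv fun w => (w - z₀) ^ e * g w) z
        + q z * ((z - z₀) ^ e * g z) = 0 := by
  obtain ⟨g, hg⟩ := exists_hasTaylorAt_of_norm_le ha z₀
  refine ⟨g, hg.analyticAt, hg.eval, ?_⟩
  have hH := HasTaylorAt.frobeniusOperator e hb hg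
  simp only [indicial_add_antidiagonal hb0, hrec, sub_self] at hH
  filter_upwards [eventually_ode_zpow_mul e hg.analyticAt hQ,
    hH.filter_mono nhdsWithin_le_nhds] with z h1 h2
  have h3 : frobeniusOperator e z₀ Q g z = 0 := h2.unique (by simp)
  rw [h1, h3, mul_zero]

theorem eventually_wronskian_zpow_mul_ne_zero {g₁ g₂ : ℂ → ℂ} {z₀ : ℂ} {e₁ e₂ : ℤ}
    (hne : e₁ ≠ e₂) (hg₁ : AnalyticAt ℂ g₁ z₀) (hg₂ : AnalyticAt ℂ g₂ z₀)
    (h₁ : g₁ z₀ ≠ 0) (h₂ : g₂ z₀ ≠ 0) :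
    ∀ᶠ z in 𝓝[≠] z₀,
      wronskian (fun w => (w - z₀) ^ e₁ * g₁ w) (fun w => (w - z₀) ^ e₂ * g₂ w) z ≠ 0 := by
  have hcont : ContinuousAt (fun z => ((e₂ : ℂ) - e₁) * (g₁ z * g₂ z)
      + (z - z₀) * (g₁ z * deriv g₂ z - g₂ z * deriv g₁ z)) z₀ := by
    have := hg₁.continuousAt
    have := hg₂.continuousAt
    have := hg₁.deriv.continuousAt
    have := hg₂.deriv.continuousAt
    fun_prop
  have hval : ((e₂ : ℂ) - e₁) * (g₁ z₀ * g₂ z₀) ≠ 0 :=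
    mul_ne_zero (sub_ne_zero.2 (by exact_mod_cast hne.symm)) (mul_ne_zero h₁ h₂)
  filter_upwards [eventually_deriv_zpow_mul e₁ hg₁, eventually_deriv_zpow_mul e₂ hg₂,
    (hcont.eventually_ne (y := 0) (by rwa [sub_self, zero_mul, add_zero])).filter_mono nhdsWithin_le_nhds,
    eventually_mem_nhdsWithin] with z hd₁ hd₂ h hz
  have h0 : z - z₀ ≠ 0 := sub_ne_zero.2 hz
  have e1 : ∀ e : ℤ, (z - z₀) ^ e = (z - z₀) ^ (e - 1) * (z - z₀) := fun e => by
    rw [← zpow_add_one₀ h0]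
    simp
  have key : wronskian (fun w => (w - z₀) ^ e₁ * g₁ w) (fun w => (w - z₀) ^ e₂ * g₂ w) z
      = (z - z₀) ^ (e₁ - 1) * (z - z₀) ^ (e₂ - 1) * (z - z₀)
        * (((e₂ : ℂ) - e₁) * (g₁ z * g₂ z)
          + (z - z₀) * (g₁ z * deriv g₂ z - g₂ z * deriv g₁ z)) := by
    rw [wronskian, hd₁, hd₂, e1 e₁, e1 e₂]
    ring
  rw [key]
  exact mul_ne_zero (mul_ne_zero (mul_ne_zero (zpow_ne_zero _ h0) (zpow_ne_zero _ h0)) h0) h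

theorem eventually_indicial_ne_zero (s x : ℂ) (j : ℂ) :
    ∀ᶠ σ in 𝓝[≠] x, (s + (σ + j)) * (s + 1 - (σ + j)) ≠ 0 := by
  have h : ∀ t : ℂ, ∀ᶠ σ in 𝓝[≠] x, σ ≠ t := fun t => by
    rcases eq_or_ne x t with rfl | h
    · exact eventually_mem_nhdsWithin
    · exact (eventually_ne_nhds h).filter_mono nhdsWithin_le_nhds
  filter_upwards [h (-s - j), h (s + 1 - j)] with σ h1 h2
  refine mul_ne_zero (fun h3 => h1 ?_) fun h3 => h2 ?_
  · linear_combination h3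
  · linear_combination -h3

/-- The resonance coefficient `c (2 m + 1) (-m)`, expressed through any solution `α` of the
recursion below the resonance. -/
theorem resonance_coeff {b : ℕ → ℂ} {f₀ : ℂ → ℂ} {c : ℕ → ℂ → ℂ} {m : ℕ}
    (hf₀ : ∀ σ : ℂ, f₀ σ = (m + σ) * (m + 1 - σ))
    (hc0 : ∀ σ : ℂ, c 0 σ = ∏ j ∈ Icc 1 (2 * m + 1), f₀ (σ + j))
    (hcrec : ∀ (j : ℕ) (σ : ℂ), f₀ (σ + (j + 1)) ≠ 0 →
      c (j + 1) σ = (∑ k ∈ range (j + 1), b (j + 1 - k) * c k σ) / f₀ (σ + (j + 1)))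
    (hccont : ContinuousAt (c (2 * m + 1)) (-m)) {α : ℕ → ℂ}
    (hα : ∀ j < 2 * m + 1, f₀ (-m + j) * α j = ∑ k ∈ range j, b (j - k) * α k) :
    c (2 * m + 1) (-m) * α 0
      = (∏ j ∈ Icc 1 (2 * m), f₀ (-m + j))
        * ∑ k ∈ range (2 * m + 1), b (2 * m + 1 - k) * α k := by
  have hf₀c : Continuous f₀ := by
    rw [funext hf₀]
    fun_prop
  have hne : ∀ j : ℂ, ∀ᶠ σ in 𝓝[≠] (-m : ℂ), f₀ (σ + j) ≠ 0 := fun j => by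
    simpa only [hf₀] using eventually_indicial_ne_zero m (-m) j
  have hf₀t : ∀ j : ℂ, Tendsto (fun σ => f₀ (σ + j)) (𝓝[≠] (-m : ℂ)) (𝓝 (f₀ (-m + j))) :=
    fun j => ((hf₀c.comp (continuous_add_const j)).tendsto _).mono_left nhdsWithin_le_nhds
  set P := ∏ j ∈ Icc 1 (2 * m), f₀ (-m + j) with hP
  have hF := hne (2 * m + 1)
  have hlim : ∀ j < 2 * m + 1,
      Tendsto (fun σ => c j σ / f₀ (σ + (2 * m + 1)) * α 0) (𝓝[≠] (-m : ℂ)) (𝓝 (P * α j)) := by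
    intro j
    induction j using Nat.strong_induction_on with
    | _ j ih =>
      intro hj
      rcases j with _ | j
      · refine Tendsto.mul_const _ ?_
        refine (tendsto_finsetProd (Icc 1 (2 * m)) fun j _ => hf₀t j).congr' ?_
        filter_upwards [hF] with σ hσ
        rw [hc0, prod_Icc_succ_top (by omega)]
        push_cast
        field_simp
      · have hfj : f₀ (-m + ((j : ℂ) + 1)) ≠ 0 := by
          rw [hf₀]
          have h1 : ((m : ℂ) + (-m + ((j : ℂ) + 1))) = ((j + 1 : ℕ) : ℂ) := by
            push_cast
            ring
          have h2 : (m + 1 - (-m + ((j : ℂ) + 1))) = ((2 * m - j : ℕ) : ℂ) := by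
            rw [Nat.cast_sub (by omega)]
            push_cast
            ring
          rw [h1, h2]
          exact mul_ne_zero (Nat.cast_ne_zero.2 (by omega)) (Nat.cast_ne_zero.2 (by omega))
        have hs : Tendsto (fun σ => (∑ k ∈ range (j + 1),
            b (j + 1 - k) * (c k σ / f₀ (σ + (2 * m + 1)) * α 0)) / f₀ (σ + (j + 1)))
            (𝓝[≠] (-m : ℂ))
            (𝓝 ((∑ k ∈ range (j + 1), b (j + 1 - k) * (P * α k)) / f₀ (-m + (j + 1)))) :=
          (tendsto_finsetSum _ fun k hk => (ih k (mem_range.1 hk)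
            ((mem_range.1 hk).trans hj)).const_mul _).div (hf₀t _) hfj
        have hval : (∑ k ∈ range (j + 1), b (j + 1 - k) * (P * α k)) / f₀ (-m + (j + 1))
            = P * α (j + 1) := by
          have h := hα (j + 1) hj
          push_cast at h
          rw [div_eq_iff hfj, mul_assoc, mul_comm (α _), h, mul_sum]
          exact sum_congr rfl fun k _ => by ring
        rw [hval] at hs
        refine hs.congr' ?_
        filter_upwards [hne (j + 1)] with σ hσ
        rw [hcrec j σ hσ, sum_div, sum_div, sum_div, sum_mul]
        exact sum_congr rfl fun k _ => by ring
  have hs : Tendsto (fun σ => ∑ k ∈ range (2 * m + 1),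
      b (2 * m + 1 - k) * (c k σ / f₀ (σ + (2 * m + 1)) * α 0)) (𝓝[≠] (-m : ℂ))
      (𝓝 (∑ k ∈ range (2 * m + 1), b (2 * m + 1 - k) * (P * α k))) :=
    tendsto_finsetSum _ fun k hk => (hlim k (mem_range.1 hk)).const_mul _
  have hs' : Tendsto (fun σ => c (2 * m + 1) σ * α 0) (𝓝[≠] (-m : ℂ))
      (𝓝 (∑ k ∈ range (2 * m + 1), b (2 * m + 1 - k) * (P * α k))) := by
    refine hs.congr' ?_
    filter_upwards [hF] with σ hσ
    rw [hcrec (2 * m) σ (by exact_mod_cast hσ), sum_div, sum_mul]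
    push_cast
    exact sum_congr rfl fun k _ => by ring
  rw [tendsto_nhds_unique ((hccont.tendsto.mono_left nhdsWithin_le_nhds).mul_const _) hs', mul_sum]
  exact sum_congr rfl fun k _ => by ring

theorem frobeniusCoeff_rec {b d : ℕ → ℂ} {j : ℕ}
    (h : d (j + 1) = 0 → ∑ k ∈ range (j + 1), b (j + 1 - k) * frobeniusCoeff b d k = 0) :
    d (j + 1) * frobeniusCoeff b d (j + 1)
      = ∑ k ∈ range (j + 1), b (j + 1 - k) * frobeniusCoeff b d k := by
  rw [frobeniusCoeff_succ]
  by_cases h0 : d (j + 1) = 0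
  · rw [h h0, h0, zero_mul]
  · exact mul_div_cancel₀ _ h0

theorem exists_frobenius_solution_of_nat {b : ℕ → ℂ} {Q q : ℂ → ℂ} {z₀ : ℂ} {m : ℕ} {e : ℤ}
    {d : ℕ → ℂ} (hb : HasTaylorAt b Q z₀) (hQ : ∀ᶠ z in 𝓝[≠] z₀, Q z = (z - z₀) ^ 2 * q z)
    (hb0 : b 0 = -m * (m + 1)) (hd : ∀ j : ℕ, d j = (m + (e + j)) * (m + 1 - (e + j)))
    (hd0 : d 0 = 0)
    (h : ∀ j, d (j + 1) = 0 →
      ∑ k ∈ range (j + 1), b (j + 1 - k) * frobeniusCoeff b d k = 0) :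
    ∃ g : ℂ → ℂ, AnalyticAt ℂ g z₀ ∧ g z₀ ≠ 0 ∧
      ∀ᶠ z in 𝓝[≠] z₀, deriv (deriv fun w => (w - z₀) ^ e * g w) z
        + q z * ((z - z₀) ^ e * g z) = 0 := by
  obtain ⟨K, M, hK, hM, hKM⟩ := hb.exists_norm_le
  have hd1 : ∀ j, d (j + 1) = 0 ∨ 1 ≤ ‖d (j + 1)‖ := by
    intro j
    have h1 : d (j + 1) = (((m + (e + (j + 1))) * (m + 1 - (e + (j + 1))) : ℤ) : ℂ) := by
      rw [hd]
      push_cast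
      ring
    rw [h1, Int.cast_eq_zero, Complex.norm_intCast]
    refine or_iff_not_imp_left.2 fun hne => ?_
    exact_mod_cast Int.one_le_abs hne
  obtain ⟨g, hg, hg0, hode⟩ := exists_frobenius_solution (e := e) hb hQ hb0
    (norm_frobeniusCoeff_le hK hM hKM hd1) (fun j => by
      rw [← hd]
      rcases j with _ | j
      · simp [hd0]
      · exact frobeniusCoeff_rec (h j))
  exact ⟨g, hg, by simp [hg0, frobeniusCoeff_zero], hode⟩

theorem hasTaylorAt_tsum_of_hasSum {b : ℕ → ℂ} {q : ℂ → ℂ} {z₀ : ℂ}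
    (hq : ∀ᶠ z in 𝓝[≠] z₀, HasSum (fun j : ℕ => b j * (z - z₀) ^ ((j : ℤ) - 2)) (q z)) :
    ∃ Q : ℂ → ℂ, HasTaylorAt b Q z₀ ∧ ∀ᶠ z in 𝓝[≠] z₀, Q z = (z - z₀) ^ 2 * q z := by
  have key : ∀ᶠ z in 𝓝[≠] z₀, HasSum (fun j => b j * (z - z₀) ^ j) ((z - z₀) ^ 2 * q z) := by
    filter_upwards [hq, eventually_mem_nhdsWithin] with z hz hne
    have h0 : z - z₀ ≠ 0 := sub_ne_zero.2 hne
    refine (hz.mul_left ((z - z₀) ^ 2)).congr_fun fun j => ?_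
    rw [zpow_sub₀ h0]
    simp only [zpow_natCast, zpow_ofNat]
    field_simp
  refine ⟨fun z => ∑' j, b j * (z - z₀) ^ j, ?_, key.mono fun z hz => hz.tsum_eq⟩
  rw [HasTaylorAt]
  filter_upwards [eventually_nhdsWithin_iff.1 key] with z hz
  refine Summable.hasSum ?_
  rcases eq_or_ne z z₀ with rfl | hne
  · refine (hasSum_single 0 fun j hj => ?_).summable
    simp [hj]
  · exact (hz hne).summable

theorem eventually_ne_zero_of_isPreconnected {f : ℂ → ℂ} {U : Set ℂ} {z₀ z₁ : ℂ}
    (hf : MeromorphicOn f U) (hU : IsPreconnected U) (h₀ : z₀ ∈ U) (h₁ : z₁ ∈ U)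
    (hf₁ : AnalyticAt ℂ f z₁) (hne : f z₁ ≠ 0) : ∀ᶠ z in 𝓝[≠] z₀, f z ≠ 0 := by
  rw [← meromorphicOrderAt_ne_top_iff_eventually_ne_zero (hf z₀ h₀)]
  refine hf.meromorphicOrderAt_ne_top_of_isPreconnected hU h₁ h₀ ?_
  rw [meromorphicOrderAt_ne_top_iff_eventually_ne_zero (hf z₁ h₁)]
  exact (hf₁.continuousAt.eventually_ne hne).filter_mono nhdsWithin_le_nhds

theorem eventually_nhdsNE_of_punctured_ball {z₀ : ℂ} {r : ℝ} (hr : 0 < r) {p : ℂ → Prop}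
    (h : ∀ z ∈ Metric.ball z₀ r \ {z₀}, p z) : ∀ᶠ z in 𝓝[≠] z₀, p z := by
  filter_upwards [mem_nhdsWithin_of_mem_nhds (Metric.ball_mem_nhds z₀ hr),
    self_mem_nhdsWithin] with z hz hne using h z ⟨hz, hne⟩

theorem exists_punctured_ball_of_eventually {z₀ : ℂ} {R : ℝ} (hR : 0 < R) {p : ℂ → Prop}
    (h : ∀ᶠ z in 𝓝[≠] z₀, p z) :
    ∃ r ∈ Set.Ioc 0 R, ∀ z ∈ Metric.ball z₀ r \ {z₀}, p z := by
  obtain ⟨r, hr, hp⟩ := Metric.eventually_nhds_iff_ball.1 (eventually_nhdsWithin_iff.1 h)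
  exact ⟨min r R, ⟨lt_min hr hR, min_le_right _ _⟩, fun z hz =>
    hp z (Metric.ball_subset_ball (min_le_left _ _) hz.1) hz.2⟩

theorem AnalyticAt.meromorphicAt_zpow_mul {g : ℂ → ℂ} {z₀ : ℂ} (hg : AnalyticAt ℂ g z₀) (e : ℤ) :
    MeromorphicAt (fun w => (w - z₀) ^ e * g w) z₀ :=
  (((MeromorphicAt.id z₀).sub (MeromorphicAt.const z₀ z₀)).zpow e).mul hg.meromorphicAt

/-- Frobenius analysis (Lemma 3.3): let `q` be meromorphic near `z₀` with
Laurent expansion `q(z) = Σ_{j≥0} q_j (z-z₀)^{j-2}`, `q_0 = -s(s+1)`,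
`Re(2s+1) ≥ 0`.  With `f₀(σ) = (s+σ)(s+1-σ)`, `c_0(σ) = 1` if `2s+1 ∉ ℕ` and
`c_0(σ) = Π_{j=1}^{2s+1} f₀(σ+j)` otherwise, and
`c_{j}(σ) = (Σ_{m=0}^{j-1} q_{j-m} c_m(σ))/f₀(σ+j)` for `j ≥ 1`, the equation
`y'' + q y = 0` has a fundamental system of solutions meromorphic near `z₀`
if and only if `s ∈ ℕ₀` and `c_{2s+1}(-s) = 0`. -/
theorem frobenius_meromorphic_fundamental_system
    (z₀ s : ℂ) (hs : 0 ≤ (2 * s + 1).re)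
    (qc : ℕ → ℂ) (hq0 : qc 0 = -s * (s + 1))
    (q : ℂ → ℂ) (R : ℝ) (hR : 0 < R)
    (hqa : AnalyticOnNhd ℂ q (Metric.ball z₀ R \ {z₀}))
    (hq : ∀ z ∈ Metric.ball z₀ R \ {z₀},
      HasSum (fun j : ℕ => qc j * (z - z₀) ^ ((j : ℤ) - 2)) (q z))
    (f₀ : ℂ → ℂ) (hf₀ : ∀ σ : ℂ, f₀ σ = (s + σ) * (s + 1 - σ))
    (c : ℕ → ℂ → ℂ)
    (hc0 : (∀ m : ℕ, (2 * s + 1 : ℂ) ≠ (m : ℂ)) → ∀ σ : ℂ, c 0 σ = 1)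
    (hc0' : ∀ m : ℕ, (2 * s + 1 : ℂ) = (m : ℂ) →
      ∀ σ : ℂ, c 0 σ = ∏ j ∈ Finset.Icc 1 m, f₀ (σ + j))
    (hcrec : ∀ (j : ℕ) (σ : ℂ), f₀ (σ + (j + 1)) ≠ 0 →
      c (j + 1) σ =
        (∑ m ∈ Finset.range (j + 1), qc (j + 1 - m) * c m σ) / f₀ (σ + (j + 1)))
    (hccont : ∀ j : ℕ, ContinuousAt (c j) (-s)) :
    (∃ r ∈ Set.Ioc (0 : ℝ) R, ∃ y₁ y₂ : ℂ → ℂ,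
      AnalyticOnNhd ℂ y₁ (Metric.ball z₀ r \ {z₀}) ∧ MeromorphicAt y₁ z₀ ∧
      AnalyticOnNhd ℂ y₂ (Metric.ball z₀ r \ {z₀}) ∧ MeromorphicAt y₂ z₀ ∧
      (∀ z ∈ Metric.ball z₀ r \ {z₀}, deriv (deriv y₁) z + q z * y₁ z = 0) ∧
      (∀ z ∈ Metric.ball z₀ r \ {z₀}, deriv (deriv y₂) z + q z * y₂ z = 0) ∧
      (∃ z ∈ Metric.ball z₀ r \ {z₀},
        y₁ z * deriv y₂ z - y₂ z * deriv y₁ z ≠ 0)) ↔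
    (∃ m : ℕ, s = (m : ℂ) ∧ c (2 * m + 1) (-s) = 0) := by
  obtain ⟨Q, hb, hQ⟩ := hasTaylorAt_tsum_of_hasSum (eventually_nhdsNE_of_punctured_ball hR hq)
  have hres : ∀ (m : ℕ), s = m → ∀ α : ℕ → ℂ,
      (∀ j < 2 * m + 1, f₀ (-m + j) * α j = ∑ k ∈ range j, qc (j - k) * α k) →
      c (2 * m + 1) (-s) * α 0 = (∏ j ∈ Icc 1 (2 * m), f₀ (-m + j))
        * ∑ k ∈ range (2 * m + 1), qc (2 * m + 1 - k) * α k := by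
    rintro m rfl α hα
    exact resonance_coeff hf₀ (hc0' (2 * m + 1) (by push_cast; ring)) hcrec (hccont _) hα
  constructor
  · rintro ⟨r, ⟨hr, -⟩, y₁, y₂, ha₁, hm₁, ha₂, hm₂, hode₁, hode₂, z₁, hz₁, hW₁⟩
    have hmero : ∀ y : ℂ → ℂ, AnalyticOnNhd ℂ y (Metric.ball z₀ r \ {z₀}) →
        MeromorphicAt y z₀ → MeromorphicOn y (Metric.ball z₀ r) := by
      intro y ha hm z hz
      rcases eq_or_ne z z₀ with rfl | hne
      · exact hm
      · exact (ha z ⟨hz, hne⟩).meromorphicAt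
    have hM₁ := hmero y₁ ha₁ hm₁
    have hM₂ := hmero y₂ ha₂ hm₂
    have hW : ∀ᶠ z in 𝓝[≠] z₀, wronskian y₁ y₂ z ≠ 0 :=
      eventually_ne_zero_of_isPreconnected
        (fun z hz => ((hM₁ z hz).mul (hM₂ z hz).deriv).sub ((hM₂ z hz).mul (hM₁ z hz).deriv))
        (convex_ball z₀ r).isPreconnected (Metric.mem_ball_self hr) hz₁.1
        (((ha₁ z₁ hz₁).mul (ha₂ z₁ hz₁).deriv).sub ((ha₂ z₁ hz₁).mul (ha₁ z₁ hz₁).deriv)) hW₁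
    have hode₂' := eventually_nhdsNE_of_punctured_ball hr hode₂
    obtain ⟨u, e₁, e₂, hne, hu, hodeu, ho₁, ho₂⟩ := exists_meromorphicOrderAt_ne hm₁ hm₂
      (eventually_nhdsNE_of_punctured_ball hr hode₁) hode₂' hW
    have expand : ∀ (y : ℂ → ℂ) (e : ℤ), MeromorphicAt y z₀ →
        (∀ᶠ z in 𝓝[≠] z₀, deriv (deriv y) z + q z * y z = 0) → meromorphicOrderAt y z₀ = e →
        ∃ a : ℕ → ℂ, a 0 ≠ 0 ∧ ∀ j : ℕ, (s + (e + j)) * (s + 1 - (e + j)) * a j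
          = ∑ k ∈ range j, qc (j - k) * a k := by
      intro y e hy hode he
      obtain ⟨a, ha0, ha⟩ := exists_coeff_of_meromorphicOrderAt_eq hb hQ hy hode he
      refine ⟨a, ha0, fun j => ?_⟩
      have h := ha j
      rw [indicial_add_antidiagonal hq0] at h
      exact (sub_eq_zero.1 h).symm
    obtain ⟨a₁, ha₁0, hrec₁⟩ := expand u e₁ hu hodeu ho₁
    obtain ⟨a₂, ha₂0, hrec₂⟩ := expand y₂ e₂ hm₂ hode₂' ho₂
    have root : ∀ (e : ℤ) (a : ℕ → ℂ), a 0 ≠ 0 → (∀ j : ℕ,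
        (s + (e + j)) * (s + 1 - (e + j)) * a j = ∑ k ∈ range j, qc (j - k) * a k) →
        (e : ℂ) = -s ∨ (e : ℂ) = s + 1 := by
      intro e a ha0 ha
      have h := ha 0
      simp only [Nat.cast_zero, add_zero, range_zero, sum_empty, mul_eq_zero, ha0, or_false] at h
      exact h.imp (fun h => by linear_combination h) fun h => by linear_combination -h
    have concl : ∀ (e : ℤ) (a : ℕ → ℂ), a 0 ≠ 0 → (∀ j : ℕ,
        (s + (e + j)) * (s + 1 - (e + j)) * a j = ∑ k ∈ range j, qc (j - k) * a k) →
        (e : ℂ) = -s → ∃ m : ℕ, s = (m : ℂ) ∧ c (2 * m + 1) (-s) = 0 := by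
      intro e a ha0 ha he
      have hse : s = ((-e : ℤ) : ℂ) := by
        push_cast
        rw [he, neg_neg]
      have he0 : 0 ≤ -e := by
        have h : (0 : ℝ) ≤ 2 * ((-e : ℤ) : ℝ) + 1 := by
          have h' := hs
          rw [hse] at h'
          simpa using h'
        have h2 : (0 : ℤ) ≤ 2 * (-e) + 1 := by exact_mod_cast h
        omega
      obtain ⟨m, hm⟩ := Int.eq_ofNat_of_zero_le he0
      have hsm : s = m := by
        rw [hse, hm]
        simp
      have hem : (e : ℂ) = -m := by rw [he, hsm]
      refine ⟨m, hsm, ?_⟩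
      have h := hres m hsm a fun j _ => by rw [hf₀, ← hem, ha]
      have h1 := ha (2 * m + 1)
      have h2 : s + 1 - ((e : ℂ) + ((2 * m + 1 : ℕ) : ℂ)) = 0 := by
        rw [hem, hsm]
        push_cast
        ring
      rw [h2, mul_zero, zero_mul] at h1
      rw [← h1, mul_zero] at h
      exact (mul_eq_zero.1 h).resolve_right ha0
    rcases root e₁ a₁ ha₁0 hrec₁ with h₁ | h₁
    · exact concl e₁ a₁ ha₁0 hrec₁ h₁
    · rcases root e₂ a₂ ha₂0 hrec₂ with h₂ | h₂
      · exact concl e₂ a₂ ha₂0 hrec₂ h₂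
      · exact absurd (Int.cast_injective (h₁.trans h₂.symm)) hne
  · rintro ⟨m, hsm, hcm⟩
    have hb0 : qc 0 = -m * (m + 1) := by rw [hq0, hsm]
    have hd : ∀ j : ℕ, f₀ (-m + j) = j * (2 * m + 1 - j) := fun j => by
      rw [hf₀, hsm]
      ring
    have hd_ne : ∀ j : ℕ, j ≠ 0 → j ≠ 2 * m + 1 → f₀ (-m + j) ≠ 0 := by
      intro j h0 h1
      rw [hd]
      refine mul_ne_zero (Nat.cast_ne_zero.2 h0) (sub_ne_zero.2 fun h => h1 ?_)
      exact_mod_cast h.symm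
    have hP : ∏ j ∈ Icc 1 (2 * m), f₀ (-m + j) ≠ 0 := prod_ne_zero_iff.2 fun j hj => by
      have := mem_Icc.1 hj
      exact hd_ne j (by omega) (by omega)
    set α := frobeniusCoeff qc fun j => f₀ (-m + j)
    have hsum : ∑ k ∈ range (2 * m + 1), qc (2 * m + 1 - k) * α k = 0 := by
      have h := hres m hsm α fun j hj => by
        rcases j with _ | j
        · simp [hf₀, hsm]
        · exact frobeniusCoeff_rec (d := fun j => f₀ (-m + j)) fun h => absurd h (hd_ne (j + 1) (by omega) (by omega))
      rw [hcm, zero_mul] at h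
      exact (mul_eq_zero.1 h.symm).resolve_left hP
    obtain ⟨g₁, hg₁, hg₁0, hode₁⟩ := exists_frobenius_solution_of_nat (e := -m)
      (d := fun j => f₀ (-m + j)) hb hQ hb0 (fun j => by simp [hf₀, hsm]) (by simp [hf₀, hsm])
      fun j hj => by
        rcases eq_or_ne j (2 * m) with rfl | hne
        · exact hsum
        · exact absurd hj (hd_ne (j + 1) (by omega) (by omega))
    obtain ⟨g₂, hg₂, hg₂0, hode₂⟩ := exists_frobenius_solution_of_nat (e := m + 1)
      (d := fun j => f₀ (m + 1 + j)) hb hQ hb0 (fun j => by simp [hf₀, hsm]) (by simp [hf₀, hsm])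
      fun j hj => by
        refine absurd hj ?_
        have h1 : f₀ (m + 1 + (j + 1 : ℕ)) = -(((2 * m + 1 + (j + 1)) * (j + 1) : ℕ) : ℂ) := by
          rw [hf₀, hsm]
          push_cast
          ring
        simp only [h1]
        exact neg_ne_zero.2 (Nat.cast_ne_zero.2 (by positivity))
    have hW := eventually_wronskian_zpow_mul_ne_zero (e₁ := -m) (e₂ := m + 1) (by omega)
      hg₁ hg₂ hg₁0 hg₂0
    have hm₁ := hg₁.meromorphicAt_zpow_mul (-m)
    have hm₂ := hg₂.meromorphicAt_zpow_mul (m + 1)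
    obtain ⟨r, hr, h⟩ := exists_punctured_ball_of_eventually hR
      (hm₁.eventually_analyticAt.and (hm₂.eventually_analyticAt.and
        (hode₁.and (hode₂.and hW))))
    obtain ⟨z₁, hz₁⟩ : (Metric.ball z₀ r \ {z₀}).Nonempty := by
      obtain ⟨z, hz, hne⟩ := Filter.nonempty_of_mem (inter_mem
        (mem_nhdsWithin_of_mem_nhds (Metric.ball_mem_nhds z₀ hr.1))
        (self_mem_nhdsWithin (s := {z₀}ᶜ)))
      exact ⟨z, hz, hne⟩
    exact ⟨r, hr, _, _, fun z hz => (h z hz).1, hm₁, fun z hz => (h z hz).2.1, hm₂,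
      fun z hz => (h z hz).2.2.1, fun z hz => (h z hz).2.2.2.1, z₁, hz₁, (h z₁ hz₁).2.2.2.2⟩
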